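/- Let F ∈ H ⊗ H be a 2-cocycle of a finite-dimensional Hopf algebra H, and define F_n ∈ H^{⊗n} by F₁ = 1, F_{n+1} = (1 ⊗ F_n)·(id ⊗ Δⁿ)(F). Then for all integers m, n ≥ 1 and all j ∈ {1, …, n+1}: F_{m+n} = I_j(F_m, 1^{⊗n}) · (id^{⊗(j-1)} ⊗ Δ^m ⊗ id^{⊗(n+1-j)})(F_{n+1}), where I_j(w, v) inserts the tensor w between the (j-1)-st and j-th tensor slots of v. -/

import Mathlib

/-!
STATEMENT 5 (Lemma `lem:trick-3`(i)):
For a 2-cocycle F of a finite-dimensional Hopf algebra H, with higher twists F_n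
(F₁ = 1, F_{n+1} = (1 ⊗ F_n)·(id ⊗ Δⁿ)(F)), for all m, n ≥ 1 and all j ∈ {1, …, n+1}:
  F_{m+n} = I_j(F_m, 1^{⊗n}) · (id^{⊗(j-1)} ⊗ Δ^m ⊗ id^{⊗(n+1-j)})(F_{n+1}),
where I_j(w, v) inserts w at position j of v, and the middle map applies Δ^m to the
j-th tensor slot of F_{n+1}.
-/

open TensorProduct

structure AlgBundle (k : Type) [CommRing k] where
  carrier : Type
  ring : Ring carrier
  alg : @Algebra k carrier _ ring.toSemiring

section
variable (k H : Type) [Field k] [Ring H] [HopfAlgebra k H]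

noncomputable def tpowB : ℕ → AlgBundle k
  | 0 => ⟨H, inferInstance, inferInstance⟩
  | n + 1 =>
      letI := (tpowB n).ring
      letI := (tpowB n).alg
      ⟨TensorProduct k H (tpowB n).carrier, inferInstance, inferInstance⟩

/-- `Tpow k H n` is the (n+1)-fold tensor power `H ⊗ (H ⊗ (⋯ ⊗ H))`. -/
noncomputable def Tpow (n : ℕ) : Type := (tpowB k H n).carrier

noncomputable instance instTpowRing (n : ℕ) : Ring (Tpow k H n) := (tpowB k H n).ring
noncomputable instance instTpowAlgebra (n : ℕ) : Algebra k (Tpow k H n) := (tpowB k H n).alg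

/-- The iterated comultiplication `Δ^{n+1} : H → H^{⊗(n+1)}`. -/
noncomputable def comulIter : ∀ n : ℕ, H →ₗ[k] Tpow k H n
  | 0 => LinearMap.id
  | n + 1 =>
      show H →ₗ[k] TensorProduct k H (Tpow k H n) from
        (TensorProduct.map LinearMap.id (comulIter n)) ∘ₗ Coalgebra.comul

/-- The higher twists of `F`:  `Fseq F n = F_{n+1}`. -/
noncomputable def Fseq (F : H ⊗[k] H) : ∀ n : ℕ, Tpow k H n
  | 0 => 1
  | n + 1 =>
      show TensorProduct k H (Tpow k H n) from
        ((1 : H) ⊗ₜ[k] Fseq F n) * (TensorProduct.map LinearMap.id (comulIter k H n) F)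

/-- Cast between tensor powers of equal length. -/
noncomputable def tcast {a b : ℕ} (h : a = b) : Tpow k H a ≃ₗ[k] Tpow k H b :=
  h ▸ LinearEquiv.refl k (Tpow k H a)

/-- The canonical identification `H^{⊗(a+1)} ⊗ H^{⊗(b+1)} ≅ H^{⊗(a+b+2)}`. -/
noncomputable def concEquiv : ∀ a b : ℕ, (Tpow k H a ⊗[k] Tpow k H b) ≃ₗ[k] Tpow k H (a + 1 + b)
  | 0, b =>
      (show (Tpow k H 0 ⊗[k] Tpow k H b) ≃ₗ[k] Tpow k H (b + 1) from
        LinearEquiv.refl k (Tpow k H 0 ⊗[k] Tpow k H b)).trans (tcast k H (by omega))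
  | a + 1, b =>
      (show (Tpow k H (a+1) ⊗[k] Tpow k H b) ≃ₗ[k] H ⊗[k] (Tpow k H a ⊗[k] Tpow k H b) from
        TensorProduct.assoc k H (Tpow k H a) (Tpow k H b)).trans
      ((TensorProduct.congr (LinearEquiv.refl k H) (concEquiv a b)).trans
        ((show (TensorProduct k H (Tpow k H (a + 1 + b))) ≃ₗ[k] Tpow k H (a + 1 + b + 1) from
            LinearEquiv.refl k _).trans (tcast k H (by omega))))

/-- `applyAt g n j` applies `g : H →ₗ H^{⊗(m'+1)}` to the j-th (0-based) tensor slot of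
`H^{⊗(n+1)}`, leaving the other slots alone. -/
noncomputable def applyAt {m' : ℕ} (g : H →ₗ[k] Tpow k H m') :
    ∀ n j : ℕ, Tpow k H n →ₗ[k] Tpow k H (n + m')
  | 0, _ =>
      show H →ₗ[k] Tpow k H (0 + m') from (tcast k H (by omega)).toLinearMap ∘ₗ g
  | n + 1, 0 =>
      show TensorProduct k H (Tpow k H n) →ₗ[k] Tpow k H (n + 1 + m') from
        (tcast k H (by omega)).toLinearMap ∘ₗ (concEquiv k H m' n).toLinearMap ∘ₗ
          (TensorProduct.map g LinearMap.id)
  | n + 1, j + 1 =>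
      show TensorProduct k H (Tpow k H n) →ₗ[k] Tpow k H (n + 1 + m') from
        (tcast k H (by omega : n + m' + 1 = n + 1 + m')).toLinearMap ∘ₗ
          (show TensorProduct k H (Tpow k H n) →ₗ[k] Tpow k H (n + m' + 1) from
            show TensorProduct k H (Tpow k H n) →ₗ[k] TensorProduct k H (Tpow k H (n + m')) from
              TensorProduct.map LinearMap.id (applyAt g n j))

/-- `insAt w n j` inserts the tensor `w : H^{⊗(p+1)}` at position j (0-based, i.e. in front
of slot j; j = n+1 appends at the end) into an element of `H^{⊗(n+1)}`. -/
noncomputable def insAt {p : ℕ} (w : Tpow k H p) :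
    ∀ n j : ℕ, Tpow k H n →ₗ[k] Tpow k H (n + p + 1)
  | n, 0 =>
      (tcast k H (by omega : p + 1 + n = n + p + 1)).toLinearMap ∘ₗ
        (concEquiv k H p n).toLinearMap ∘ₗ (TensorProduct.mk k (Tpow k H p) (Tpow k H n) w)
  | 0, _ + 1 =>
      (tcast k H (by omega : 0 + 1 + p = 0 + p + 1)).toLinearMap ∘ₗ
        (concEquiv k H 0 p).toLinearMap ∘ₗ
        ((TensorProduct.mk k (Tpow k H 0) (Tpow k H p)).flip w)
  | n + 1, j + 1 =>
      (tcast k H (by omega : n + p + 1 + 1 = n + 1 + p + 1)).toLinearMap ∘ₗ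
        (show TensorProduct k H (Tpow k H n) →ₗ[k] Tpow k H (n + p + 1 + 1) from
          show TensorProduct k H (Tpow k H n) →ₗ[k] TensorProduct k H (Tpow k H (n + p + 1)) from
            TensorProduct.map LinearMap.id (insAt w n j))

end


section helpers
variable {k H : Type} [Field k] [Ring H] [HopfAlgebra k H]

/-- Key computation: the cocycle identity pushed through arbitrary algebra maps. -/
theorem cocycle_push {A B : Type} [Ring A] [Algebra k A] [Ring B] [Algebra k B]
    (F : H ⊗[k] H)
    (hcoc : ((1 : H) ⊗ₜ[k] F) *
        (TensorProduct.map LinearMap.id (Coalgebra.comul (R := k)) F) =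
      (TensorProduct.assoc k H H H)
        ((F ⊗ₜ[k] (1 : H)) *
          (TensorProduct.map (Coalgebra.comul (R := k)) LinearMap.id F)))
    (a : H →ₐ[k] A) (b : H →ₐ[k] B) (x : A) (y : B) :
    TensorProduct.assoc k H A B
      (((((1 : H) ⊗ₜ[k] x) * TensorProduct.map LinearMap.id a.toLinearMap F) ⊗ₜ[k] (1 : B)) *
        TensorProduct.map (TensorProduct.map LinearMap.id a.toLinearMap ∘ₗ Coalgebra.comul)
          LinearMap.id
          (((1 : H) ⊗ₜ[k] y) * TensorProduct.map LinearMap.id b.toLinearMap F)) =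
    ((1 : H) ⊗ₜ[k] ((x ⊗ₜ[k] (1 : B)) *
        TensorProduct.map a.toLinearMap LinearMap.id
          (((1 : H) ⊗ₜ[k] y) * TensorProduct.map LinearMap.id b.toLinearMap F))) *
      TensorProduct.map LinearMap.id
        (TensorProduct.map a.toLinearMap b.toLinearMap ∘ₗ Coalgebra.comul) F := by
  let Φ : H ⊗[k] (H ⊗[k] H) →ₐ[k] H ⊗[k] (A ⊗[k] B) :=
    Algebra.TensorProduct.map (AlgHom.id k H) (Algebra.TensorProduct.map a b)
  have assoc_mul : ∀ u v : (H ⊗[k] A) ⊗[k] B, TensorProduct.assoc k H A B (u * v) =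
      TensorProduct.assoc k H A B u * TensorProduct.assoc k H A B v :=
    fun u v => map_mul (Algebra.TensorProduct.assoc k k k H A B) u v
  have assoc_mul' : ∀ u v : (H ⊗[k] H) ⊗[k] H, TensorProduct.assoc k H H H (u * v) =
      TensorProduct.assoc k H H H u * TensorProduct.assoc k H H H v :=
    fun u v => map_mul (Algebra.TensorProduct.assoc k k k H H H) u v
  have c1 : ∀ G : H ⊗[k] H,
      TensorProduct.assoc k H A B ((TensorProduct.map LinearMap.id a.toLinearMap G) ⊗ₜ[k] (1 : B))
      = Φ (TensorProduct.assoc k H H H (G ⊗ₜ[k] (1 : H))) := by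
    intro G
    induction G with
    | zero => simp
    | add u v hu hv => simp only [map_add, TensorProduct.add_tmul, hu, hv]
    | tmul u v => simp [Φ]
  have c2' : ∀ (G : H ⊗[k] H) (h : H),
      TensorProduct.assoc k H A B ((TensorProduct.map LinearMap.id a.toLinearMap G) ⊗ₜ[k] (b h))
      = Φ (TensorProduct.assoc k H H H (G ⊗ₜ[k] h)) := by
    intro G h
    induction G with
    | zero => simp
    | add u v hu hv => simp only [map_add, TensorProduct.add_tmul, hu, hv]
    | tmul u v => simp [Φ]
  have c2 : ∀ G : H ⊗[k] H, TensorProduct.assoc k H A B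
      (TensorProduct.map (TensorProduct.map LinearMap.id a.toLinearMap ∘ₗ Coalgebra.comul)
          LinearMap.id (((1 : H) ⊗ₜ[k] y) * TensorProduct.map LinearMap.id b.toLinearMap G))
      = ((1 : H) ⊗ₜ[k] ((1 : A) ⊗ₜ[k] y)) * Φ (TensorProduct.assoc k H H H
          (TensorProduct.map (Coalgebra.comul (R := k)) LinearMap.id G)) := by
    intro G
    induction G with
    | zero => simp
    | add u v hu hv => simp only [map_add, mul_add, hu, hv]
    | tmul u v =>
      simp only [TensorProduct.map_tmul, LinearMap.id_apply, Algebra.TensorProduct.tmul_mul_tmul,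
        one_mul, LinearMap.comp_apply, AlgHom.toLinearMap_apply]
      rw [← c2']
      have : ∀ G' : H ⊗[k] A, G' ⊗ₜ[k] (y * b v) = (1 ⊗ₜ[k] y) * (G' ⊗ₜ[k] b v) := by
        intro G'; simp
      rw [this, assoc_mul]
      rfl
  have c3 : ∀ G : H ⊗[k] H, (x ⊗ₜ[k] (1 : B)) * TensorProduct.map a.toLinearMap LinearMap.id
          (((1 : H) ⊗ₜ[k] y) * TensorProduct.map LinearMap.id b.toLinearMap G)
      = (x ⊗ₜ[k] y) * Algebra.TensorProduct.map a b G := by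
    intro G
    induction G with
    | zero => simp
    | add u v hu hv => simp only [map_add, mul_add, hu, hv]
    | tmul u v => simp
  have c4 : ∀ G : H ⊗[k] H, TensorProduct.map LinearMap.id
        (TensorProduct.map a.toLinearMap b.toLinearMap ∘ₗ Coalgebra.comul) G
      = Φ (TensorProduct.map LinearMap.id (Coalgebra.comul (R := k)) G) := by
    intro G
    induction G with
    | zero => simp
    | add u v hu hv => simp only [map_add, hu, hv]
    | tmul u v => simp [Φ]; rfl
  have c5 : ∀ G : H ⊗[k] A, TensorProduct.assoc k H A B ((((1 : H) ⊗ₜ[k] x) * G) ⊗ₜ[k] (1 : B)) =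
      ((1 : H) ⊗ₜ[k] (x ⊗ₜ[k] (1 : B))) * TensorProduct.assoc k H A B (G ⊗ₜ[k] (1 : B)) := by
    intro G
    have : (((1 : H) ⊗ₜ[k] x) * G) ⊗ₜ[k] (1 : B) =
      (((1 : H) ⊗ₜ[k] x) ⊗ₜ[k] (1 : B)) * (G ⊗ₜ[k] (1 : B)) := by simp
    rw [this, assoc_mul]; rfl
  have c6 : ∀ G : H ⊗[k] H,
      Φ (TensorProduct.assoc k H H H (G ⊗ₜ[k] (1 : H))) * ((1 : H) ⊗ₜ[k] ((1 : A) ⊗ₜ[k] y)) =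
      ((1 : H) ⊗ₜ[k] ((1 : A) ⊗ₜ[k] y)) * Φ (TensorProduct.assoc k H H H (G ⊗ₜ[k] (1 : H))) := by
    intro G
    induction G with
    | zero => simp
    | add u v hu hv => simp only [map_add, TensorProduct.add_tmul, mul_add, add_mul, hu, hv]
    | tmul u v => simp [Φ]
  have c7 : ∀ G : H ⊗[k] H, (1 : H) ⊗ₜ[k] ((x ⊗ₜ[k] y) * Algebra.TensorProduct.map a b G)
      = ((1 : H) ⊗ₜ[k] (x ⊗ₜ[k] y)) * Φ ((1 : H) ⊗ₜ[k] G) := by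
    intro G
    simp [Φ]
  rw [assoc_mul, c5, c1, c2, c3, c4, c7, mul_assoc, mul_assoc, ← map_mul, hcoc, assoc_mul',
    map_mul, ← mul_assoc (Φ _), c6, mul_assoc, ← mul_assoc, Algebra.TensorProduct.tmul_mul_tmul,
    Algebra.TensorProduct.tmul_mul_tmul]
  simp

/-- The tautological identification `H ⊗ H^{⊗(n+1)} = H^{⊗(n+2)}`. -/
noncomputable def tcons (n : ℕ) : (H ⊗[k] Tpow k H n) ≃ₐ[k] Tpow k H (n + 1) :=
  show (H ⊗[k] Tpow k H n) ≃ₐ[k] (H ⊗[k] Tpow k H n) from AlgEquiv.refl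

theorem tcast_rfl {a : ℕ} (h : a = a) (x : Tpow k H a) : tcast k H h x = x := rfl

theorem tcast_tcast {a b c : ℕ} (h : a = b) (h' : b = c) (x : Tpow k H a) :
    tcast k H h' (tcast k H h x) = tcast k H (h.trans h') x := by
  subst h; subst h'; rfl

theorem tcast_mul {a b : ℕ} (h : a = b) (x y : Tpow k H a) :
    tcast k H h (x * y) = tcast k H h x * tcast k H h y := by
  subst h; rfl

theorem tcast_one {a b : ℕ} (h : a = b) : tcast k H h (1 : Tpow k H a) = 1 := by
  subst h; rfl

theorem tcast_Fseq {a b : ℕ} (h : a = b) (F : H ⊗[k] H) :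
    tcast k H h (Fseq k H F a) = Fseq k H F b := by
  subst h; rfl

theorem tcast_comulIter {a b : ℕ} (h : a = b) (x : H) :
    tcast k H h (comulIter k H a x) = comulIter k H b x := by
  subst h; rfl

theorem tcons_tcast {a b : ℕ} (h : a = b) (x : H ⊗[k] Tpow k H a) :
    tcons b (TensorProduct.map LinearMap.id (tcast k H h).toLinearMap x) =
      tcast k H (congrArg (· + 1) h) (tcons a x) := by
  subst h
  have : (tcast k H (rfl : a = a)).toLinearMap = LinearMap.id := rfl
  rw [this, TensorProduct.map_id]; rfl

theorem conc_zero (b : ℕ) (x : H ⊗[k] Tpow k H b) :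
    concEquiv k H 0 b x = tcast k H (by omega) (tcons b x) := rfl

theorem conc_succ (a b : ℕ) (x : (H ⊗[k] Tpow k H a) ⊗[k] Tpow k H b) :
    concEquiv k H (a + 1) b x = tcast k H (by omega) (tcons (a + 1 + b)
      (TensorProduct.map LinearMap.id (concEquiv k H a b).toLinearMap
        (TensorProduct.assoc k H (Tpow k H a) (Tpow k H b) x))) := rfl

theorem map_id_mul {A B C : Type} [Ring A] [Algebra k A] [Ring B] [Algebra k B]
    [Ring C] [Algebra k C]
    (f : A →ₗ[k] B) (hf : ∀ x y, f (x * y) = f x * f y) (u v : C ⊗[k] A) :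
    TensorProduct.map (LinearMap.id : C →ₗ[k] C) f (u * v) =
      TensorProduct.map LinearMap.id f u * TensorProduct.map LinearMap.id f v := by
  induction u with
  | zero => simp
  | add u u' hu hv => simp only [map_add, add_mul, hu, hv]
  | tmul p q =>
    induction v with
    | zero => simp
    | add u u' hu hv => simp only [map_add, mul_add, hu, hv]
    | tmul r s => simp [hf]

theorem map_mul_id {A B C : Type} [Ring A] [Algebra k A] [Ring B] [Algebra k B]
    [Ring C] [Algebra k C]
    (f : A →ₗ[k] B) (hf : ∀ x y, f (x * y) = f x * f y) (u v : A ⊗[k] C) :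
    TensorProduct.map f (LinearMap.id : C →ₗ[k] C) (u * v) =
      TensorProduct.map f LinearMap.id u * TensorProduct.map f LinearMap.id v := by
  induction u with
  | zero => simp
  | add u u' hu hv => simp only [map_add, add_mul, hu, hv]
  | tmul p q =>
    induction v with
    | zero => simp
    | add u u' hu hv => simp only [map_add, mul_add, hu, hv]
    | tmul r s => simp [hf]

theorem conc_mul (a b : ℕ) (x y : Tpow k H a ⊗[k] Tpow k H b) :
    concEquiv k H a b (x * y) = concEquiv k H a b x * concEquiv k H a b y := by
  induction a with
  | zero =>
    change H ⊗[k] Tpow k H b at x y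
    exact (congrArg (tcast k H (show b + 1 = 0 + 1 + b by omega)) (map_mul (tcons b) x y)).trans
      (tcast_mul _ _ _)
  | succ a ih =>
    change (H ⊗[k] Tpow k H a) ⊗[k] Tpow k H b at x y
    have : ∀ u v : (H ⊗[k] Tpow k H a) ⊗[k] Tpow k H b, TensorProduct.assoc k H _ _ (u * v) =
      TensorProduct.assoc k H _ _ u * TensorProduct.assoc k H _ _ v :=
      fun u v => map_mul (Algebra.TensorProduct.assoc k k k H _ _) u v
    have h1 := this x y
    have h2 := (congrArg (TensorProduct.map (LinearMap.id : H →ₗ[k] H)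
      (concEquiv k H a b).toLinearMap) h1).trans (map_id_mul _ ih _ _)
    have h3 := (congrArg (tcons (a + 1 + b)) h2).trans (map_mul (tcons (a + 1 + b)) _ _)
    exact (congrArg (tcast k H (show a + 1 + b + 1 = a + 1 + 1 + b by omega)) h3).trans
      (tcast_mul _ _ _)

theorem conc_one (a b : ℕ) : concEquiv k H a b 1 = 1 := by
  have h := conc_mul (k := k) (H := H) a b 1 ((concEquiv k H a b).symm 1)
  rw [one_mul, LinearEquiv.apply_symm_apply, mul_one] at h
  exact h.symm

theorem comulIter_succ (n : ℕ) (x : H) : comulIter k H (n + 1) x =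
    tcons n (TensorProduct.map LinearMap.id (comulIter k H n) (Coalgebra.comul (R := k) x)) := rfl

theorem comulIter_mul (n : ℕ) (x y : H) :
    comulIter k H n (x * y) = comulIter k H n x * comulIter k H n y := by
  induction n generalizing x y with
  | zero => rfl
  | succ n ih =>
    rw [comulIter_succ, comulIter_succ, comulIter_succ, ← map_mul, ← map_id_mul _ ih,
      Bialgebra.comul_mul]

theorem comulIter_one (n : ℕ) : comulIter k H n (1 : H) = 1 := by
  induction n with
  | zero => rfl
  | succ n ih =>
    rw [comulIter_succ, Bialgebra.comul_one, Algebra.TensorProduct.one_def,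
      TensorProduct.map_tmul, ih]
    rfl

/-- The iterated comultiplication as an algebra map. -/
noncomputable def comulIterAlg (n : ℕ) : H →ₐ[k] Tpow k H n :=
  AlgHom.ofLinearMap (comulIter k H n) (comulIter_one n) (comulIter_mul n)

theorem comulIterAlg_toLinearMap (n : ℕ) :
    (comulIterAlg n).toLinearMap = comulIter k H n := rfl

theorem Fseq_succ (F : H ⊗[k] H) (n : ℕ) : Fseq k H F (n + 1) =
    tcons n (((1 : H) ⊗ₜ[k] Fseq k H F n) *
      (TensorProduct.map LinearMap.id (comulIter k H n) F)) := rfl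

theorem conc_comul (a b : ℕ) : (concEquiv k H a b).toLinearMap ∘ₗ
      TensorProduct.map (comulIter k H a) (comulIter k H b) ∘ₗ Coalgebra.comul
      = comulIter k H (a + 1 + b) := by
  induction a with
  | zero =>
    ext x
    rw [← tcast_comulIter (show b + 1 = 0 + 1 + b by omega), comulIter_succ]
    rfl
  | succ a ih =>
    ext x
    rw [← tcast_comulIter (show a + 1 + b + 1 = a + 1 + 1 + b by omega), comulIter_succ, ← ih]
    have key : ∀ G : H ⊗[k] H,
        TensorProduct.assoc k H (Tpow k H a) (Tpow k H b)
          (TensorProduct.map (TensorProduct.map LinearMap.id (comulIter k H a) ∘ₗ Coalgebra.comul)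
            (comulIter k H b) G) =
        TensorProduct.map LinearMap.id (TensorProduct.map (comulIter k H a) (comulIter k H b))
          (TensorProduct.assoc k H H H
            (TensorProduct.map (Coalgebra.comul (R := k)) LinearMap.id G)) := by
      intro G
      induction G with
      | zero => simp
      | add u v hu hv => simp only [map_add, hu, hv]
      | tmul u v =>
        simp only [TensorProduct.map_tmul, LinearMap.comp_apply, LinearMap.id_apply]
        generalize Coalgebra.comul (R := k) u = G'
        induction G' with
        | zero => simp
        | add u v hu hv => simp only [map_add, TensorProduct.add_tmul, hu, hv]
        | tmul u v => simp
    have h1 := key (Coalgebra.comul (R := k) x)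
    have h2 := Coalgebra.coassoc_apply (R := k) x
    change TensorProduct.assoc k H H H (TensorProduct.map Coalgebra.comul LinearMap.id _) =
      TensorProduct.map LinearMap.id Coalgebra.comul _ at h2
    rw [h2] at h1
    change concEquiv k H (a + 1) b (TensorProduct.map _ _ _) = _
    erw [conc_succ]
    erw [h1]
    rw [← LinearMap.comp_apply (TensorProduct.map _ _), ← TensorProduct.map_comp,
      ← LinearMap.comp_apply (TensorProduct.map _ _), ← TensorProduct.map_comp]
    rfl

theorem main_zero (F : H ⊗[k] H)
    (hcoc : ((1 : H) ⊗ₜ[k] F) *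
        (TensorProduct.map LinearMap.id (Coalgebra.comul (R := k)) F) =
      (TensorProduct.assoc k H H H)
        ((F ⊗ₜ[k] (1 : H)) *
          (TensorProduct.map (Coalgebra.comul (R := k)) LinearMap.id F))) (M N : ℕ) :
    Fseq k H F (M + 1 + N) = concEquiv k H M N ((Fseq k H F M ⊗ₜ[k] (1 : Tpow k H N)) *
      TensorProduct.map (comulIter k H M) LinearMap.id
        (((1 : H) ⊗ₜ[k] Fseq k H F N) *
          (TensorProduct.map LinearMap.id (comulIter k H N) F))) := by
  induction M with
  | zero =>
    rw [← tcast_Fseq (show N + 1 = 0 + 1 + N by omega), Fseq_succ]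
    erw [conc_zero]
    have : comulIter k H 0 = LinearMap.id := rfl
    erw [this, TensorProduct.map_id]
    exact congrArg (fun z => tcast k H (show N + 1 = 0 + 1 + N by omega) (tcons N z))
      (one_mul (_ : H ⊗[k] Tpow k H N)).symm
  | succ M ih =>
    rw [← tcast_Fseq (show M + 1 + N + 1 = M + 1 + 1 + N by omega), Fseq_succ, ih, ← conc_comul]
    have h := cocycle_push F hcoc (comulIterAlg M) (comulIterAlg N) (Fseq k H F M) (Fseq k H F N)
    simp only [comulIterAlg_toLinearMap] at h
    erw [conc_succ, h]
    rw [map_id_mul _ (conc_mul M N)]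
    congr 3
    rw [← LinearMap.comp_apply (TensorProduct.map _ _), ← TensorProduct.map_comp]
    rfl

theorem applyAt_ss {m' : ℕ} (g : H →ₗ[k] Tpow k H m') (n j : ℕ) (x : H ⊗[k] Tpow k H n) :
    applyAt k H g (n + 1) (j + 1) (tcons n x) = tcast k H (by omega) (tcons (n + m')
      (TensorProduct.map LinearMap.id (applyAt k H g n j) x)) := rfl

theorem applyAt_sz {m' : ℕ} (g : H →ₗ[k] Tpow k H m') (n : ℕ) (x : H ⊗[k] Tpow k H n) :
    applyAt k H g (n + 1) 0 (tcons n x) = tcast k H (by omega) (concEquiv k H m' n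
      (TensorProduct.map g LinearMap.id x)) := rfl

theorem applyAt_z {m' : ℕ} (g : H →ₗ[k] Tpow k H m') (j : ℕ) (x : H) :
    applyAt k H g 0 j x = tcast k H (by omega) (g x) := rfl

theorem applyAt_mul {m' : ℕ} (g : H →ₗ[k] Tpow k H m') (hg : ∀ x y, g (x * y) = g x * g y)
    (n j : ℕ) (x y : Tpow k H n) :
    applyAt k H g n j (x * y) = applyAt k H g n j x * applyAt k H g n j y := by
  induction n generalizing j with
  | zero =>
    exact (congrArg (tcast k H (show m' = 0 + m' by omega)) (hg x y)).trans (tcast_mul _ _ _)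
  | succ n ih =>
    obtain ⟨x, rfl⟩ := (tcons n).surjective x
    obtain ⟨y, rfl⟩ := (tcons n).surjective y
    rw [← map_mul]
    cases j with
    | zero =>
      rw [applyAt_sz, applyAt_sz, applyAt_sz, ← tcast_mul, ← conc_mul, map_mul_id _ hg]
    | succ j =>
      rw [applyAt_ss, applyAt_ss, applyAt_ss, ← tcast_mul, ← map_mul, map_id_mul _ (ih j)]

theorem applyAt_comulIter (m n j : ℕ) :
    applyAt k H (comulIter k H m) n j ∘ₗ comulIter k H n = comulIter k H (n + m) := by
  induction n generalizing j with
  | zero =>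
    ext x
    rw [← tcast_comulIter (show m = 0 + m by omega)]; rfl
  | succ n ih =>
    ext x
    rw [LinearMap.comp_apply, comulIter_succ]
    cases j with
    | zero =>
      rw [applyAt_sz, ← tcast_comulIter (show m + 1 + n = n + 1 + m by omega), ← conc_comul]
      congr 1
      rw [← LinearMap.comp_apply (TensorProduct.map _ _), ← TensorProduct.map_comp]
      rfl
    | succ j =>
      rw [applyAt_ss, ← tcast_comulIter (show n + m + 1 = n + 1 + m by omega), comulIter_succ,
        ← ih j]
      congr 2
      rw [← LinearMap.comp_apply (TensorProduct.map _ _), ← TensorProduct.map_comp]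
      rfl

theorem insAt_z {p : ℕ} (w : Tpow k H p) (n : ℕ) (x : Tpow k H n) :
    insAt k H w n 0 x = tcast k H (by omega) (concEquiv k H p n (w ⊗ₜ x)) := by
  cases n <;> rfl

theorem insAt_zs {p : ℕ} (w : Tpow k H p) (j : ℕ) (x : H) :
    insAt k H w 0 (j + 1) x = tcast k H (by omega) (tcons p (x ⊗ₜ w)) :=
  tcast_tcast (show p + 1 = 0 + 1 + p by omega) (show 0 + 1 + p = 0 + p + 1 by omega)
    (tcons p (x ⊗ₜ w))

theorem insAt_ss {p : ℕ} (w : Tpow k H p) (n j : ℕ) (x : H ⊗[k] Tpow k H n) :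
    insAt k H w (n + 1) (j + 1) (tcons n x) = tcast k H (by omega) (tcons (n + p + 1)
      (TensorProduct.map LinearMap.id (insAt k H w n j) x)) := rfl

theorem Fseq_apply (F : H ⊗[k] H) (m n j : ℕ) :
    applyAt k H (comulIter k H m) (n + 1) (j + 1) (Fseq k H F (n + 1)) =
      tcast k H (by omega) (tcons (n + m)
        (((1 : H) ⊗ₜ[k] applyAt k H (comulIter k H m) n j (Fseq k H F n)) *
          TensorProduct.map LinearMap.id (comulIter k H (n + m)) F)) := by
  rw [Fseq_succ, applyAt_ss, map_id_mul _ (applyAt_mul _ (comulIter_mul m) n j),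
    TensorProduct.map_tmul, ← applyAt_comulIter m n j]
  congr 3
  rw [← LinearMap.comp_apply (TensorProduct.map _ _), ← TensorProduct.map_comp]
  rfl

theorem Fseq_succ_tcast (F : H ⊗[k] H) {a b : ℕ} (h : a = b) (X : Tpow k H a)
    (Y : Tpow k H a) (hX : Fseq k H F b = tcast k H h (X * Y)) :
    Fseq k H F (b + 1) = tcast k H (congrArg (· + 1) h)
      (tcons a ((1 : H) ⊗ₜ[k] X) * tcons a (((1 : H) ⊗ₜ[k] Y) *
          TensorProduct.map LinearMap.id (comulIter k H a) F)) := by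
  subst h
  rw [tcast_rfl] at hX
  rw [tcast_rfl, Fseq_succ, hX, ← map_mul, ← mul_assoc, Algebra.TensorProduct.tmul_mul_tmul,
    one_mul]

theorem main_gen (F : H ⊗[k] H)
    (hcoc : ((1 : H) ⊗ₜ[k] F) *
        (TensorProduct.map LinearMap.id (Coalgebra.comul (R := k)) F) =
      (TensorProduct.assoc k H H H)
        ((F ⊗ₜ[k] (1 : H)) *
          (TensorProduct.map (Coalgebra.comul (R := k)) LinearMap.id F))) (M N J : ℕ)
    (hJ : J ≤ N + 1) :
    Fseq k H F (N + 1 + M) =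
      tcast k H (by omega) (insAt k H (Fseq k H F M) N J 1) *
        applyAt k H (comulIter k H M) (N + 1) J (Fseq k H F (N + 1)) := by
  induction N generalizing J with
  | zero =>
    cases J with
    | zero =>
      rw [insAt_z, Fseq_succ, applyAt_sz, tcast_tcast, ← tcast_mul, ← conc_mul,
        ← main_zero F hcoc, tcast_Fseq]
    | succ J =>
      have h0 : applyAt k H (comulIter k H M) 0 J (Fseq k H F 0) = 1 := by
        have := applyAt_z (comulIter k H M) J (1 : H)
        rw [comulIter_one, tcast_one] at this
        exact this
      have h1 := insAt_zs (Fseq k H F M) J (1 : H)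
      have h2 := congrArg (tcast k H (show 0 + M + 1 = 0 + 1 + M by omega)) h1
      have h3 := Fseq_succ_tcast F (show 0 + M = M by omega)
        (tcast k H (show M = 0 + M by omega) (Fseq k H F M)) 1
        (by rw [mul_one, tcast_tcast]; rfl)
      have h4 := tcons_tcast (k := k) (H := H) (show M = 0 + M by omega)
        ((1 : H) ⊗ₜ[k] Fseq k H F M)
      rw [TensorProduct.map_tmul] at h4
      rw [Fseq_apply, ← tcast_Fseq (show M + 1 = 0 + 1 + M by omega), h0, h3, tcast_tcast,
        tcast_mul]
      congr 1
      refine Eq.trans ?_ h2.symm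
      erw [h4]
  | succ N ih =>
    cases J with
    | zero =>
      rw [insAt_z, Fseq_succ, applyAt_sz, tcast_tcast, ← tcast_mul, ← conc_mul,
        ← main_zero F hcoc, tcast_Fseq]
    | succ J =>
      have h1 : (1 : Tpow k H (N + 1)) = tcons N ((1 : H) ⊗ₜ[k] (1 : Tpow k H N)) := rfl
      have h2 : N + 1 + M + 1 = N + 1 + 1 + M := by omega
      have ih' := ih J (by omega)
      have h3 := Fseq_succ_tcast F (rfl : N + 1 + M = N + 1 + M) _ _ ih'
      rw [Fseq_apply, h1, insAt_ss, ← tcast_Fseq h2, h3, tcast_tcast, tcast_tcast,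
        TensorProduct.map_tmul, tcast_mul]
      congr 1
      have := tcons_tcast (k := k) (H := H) (show N + M + 1 = N + 1 + M by omega)
        ((1 : H) ⊗ₜ[k] (insAt k H (Fseq k H F M) N J 1))
      rw [TensorProduct.map_tmul] at this
      erw [this]
      rw [tcast_tcast]
      rfl

end helpers

theorem statement5
    (k H : Type) [Field k] [Ring H] [HopfAlgebra k H] [FiniteDimensional k H]
    (F F' : H ⊗[k] H)
    (hinv₁ : F * F' = 1) (hinv₂ : F' * F = 1)
    (hcu₁ : (TensorProduct.lid k H)
      ((TensorProduct.map (Coalgebra.counit (R := k)) LinearMap.id) F) = 1)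
    (hcu₂ : (TensorProduct.rid k H)
      ((TensorProduct.map LinearMap.id (Coalgebra.counit (R := k))) F) = 1)
    (hcoc : ((1 : H) ⊗ₜ[k] F) *
        (TensorProduct.map LinearMap.id (Coalgebra.comul (R := k)) F) =
      (TensorProduct.assoc k H H H)
        ((F ⊗ₜ[k] (1 : H)) *
          (TensorProduct.map (Coalgebra.comul (R := k)) LinearMap.id F)))
    (m n j : ℕ) (hm : 1 ≤ m) (hn : 1 ≤ n) (hj₁ : 1 ≤ j) (hj₂ : j ≤ n + 1) :
    Fseq k H F (m + n - 1) =
      (tcast k H (by omega : (n - 1) + (m - 1) + 1 = m + n - 1))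
          (insAt k H (Fseq k H F (m - 1)) (n - 1) (j - 1) (1 : Tpow k H (n - 1))) *
      (tcast k H (by omega : n + (m - 1) = m + n - 1))
          (applyAt k H (comulIter k H (m - 1)) n (j - 1) (Fseq k H F n)) := by

  obtain ⟨M, rfl⟩ : ∃ M, m = M + 1 := ⟨m - 1, by omega⟩
  obtain ⟨N, rfl⟩ : ∃ N, n = N + 1 := ⟨n - 1, by omega⟩
  obtain ⟨J, rfl⟩ : ∃ J, j = J + 1 := ⟨j - 1, by omega⟩
  have h := main_gen F hcoc M N J (by omega)
  have h2 : N + 1 + M = M + 1 + (N + 1) - 1 := by omega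
  have h3 := congrArg (tcast k H h2) h
  rw [tcast_Fseq, tcast_mul, tcast_tcast] at h3
  exact h3
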